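/- For each three-box Young diagram Q ∈ {[3], [21], [111]}, the SO quantum dimension d_Q and the Schur function S_Q satisfy d_Q − σ(d_Q) = 2·S_Q in ℚ(A,q), where σ is the ℚ(q)-algebra field automorphism of ℚ(A,q) sending A to −A (i.e. d_Q(A,q) − d_Q(−A,q) = 2·S_Q(A,q)). -/

import Mathlib

/- STATEMENT 3: For each three-box Young diagram Q ∈ {[3],[21],[111]}, the SO quantum
dimension d_Q and the Schur function S_Q satisfy d_Q(A,q) − d_Q(−A,q) = 2·S_Q(A,q)
in ℚ(A,q), where A ↦ −A is the ℚ(q)-algebra automorphism of ℚ(A,q). -/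

noncomputable section

open MvPolynomial

/-- The field `ℚ(A, q)` of rational functions in two variables over `ℚ`. -/
abbrev F : Type := FractionRing (MvPolynomial (Fin 2) ℚ)

/-- The variable `A` in `ℚ(A, q)`. -/
def A : F := algebraMap (MvPolynomial (Fin 2) ℚ) F (X 0)

/-- The variable `q` in `ℚ(A, q)`. -/
def q : F := algebraMap (MvPolynomial (Fin 2) ℚ) F (X 1)

/-- The quantum bracket `{x} = x - x⁻¹`. -/
def br (x : F) : F := x - x⁻¹

/-- The Schur function `S₍₃₎`, as a rational expression in its two arguments. -/
def S₃ (a x : F) : F :=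
  br a * br (a * x) * br (a * x ^ 2) / (br x * br (x ^ 2) * br (x ^ 3))

/-- The Schur function `S₍₂₁₎`. -/
def S₂₁ (a x : F) : F :=
  br a * br (a * x) * br (a * x⁻¹) / (br x ^ 2 * br (x ^ 3))

/-- The Schur function `S₍₁₁₁₎`. -/
def S₁₁₁ (a x : F) : F :=
  br a * br (a * x⁻¹) * br (a * (x ^ 2)⁻¹) / (br x * br (x ^ 2) * br (x ^ 3))

/-- The SO quantum dimension `d₍₃₎`. -/
def d₃ (a x : F) : F := (1 + br (x ^ 3) / br (a * x ^ 2)) * S₃ a x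

/-- The SO quantum dimension `d₍₂₁₎`. -/
def d₂₁ (a x : F) : F := (1 + br (x ^ 3) / br a) * S₂₁ a x

/-- The SO quantum dimension `d₍₁₁₁₎`. -/
def d₁₁₁ (a x : F) : F := (1 + br (x ^ 3) / br (a * (x ^ 2)⁻¹)) * S₁₁₁ a x

theorem br_neg (x : F) : br (-x) = -br x := by
  simp only [br, inv_neg]
  ring

theorem S₃_neg (a x : F) : S₃ (-a) x = -S₃ a x := by
  simp only [S₃, neg_mul, br_neg]
  ring

theorem S₂₁_neg (a x : F) : S₂₁ (-a) x = -S₂₁ a x := by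
  simp only [S₂₁, neg_mul, br_neg]
  ring

theorem S₁₁₁_neg (a x : F) : S₁₁₁ (-a) x = -S₁₁₁ a x := by
  simp only [S₁₁₁, neg_mul, br_neg]
  ring

theorem so_minus_su_three_boxes :
    d₃ A q - d₃ (-A) q = 2 * S₃ A q ∧
    d₂₁ A q - d₂₁ (-A) q = 2 * S₂₁ A q ∧
    d₁₁₁ A q - d₁₁₁ (-A) q = 2 * S₁₁₁ A q := by
  refine ⟨?_, ?_, ?_⟩
  · simp only [d₃, S₃_neg, neg_mul, br_neg, div_neg]
    ring
  · simp only [d₂₁, S₂₁_neg, br_neg, div_neg]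
    ring
  · simp only [d₁₁₁, S₁₁₁_neg, neg_mul, br_neg, div_neg]
    ring

end
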